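/- Let A ∈ M_n(ℂ) be such that its first n−1 rows are linearly independent and its n-th row is zero (i.e. e_n·e_n = 0). Let d be a derivation of E(A) with matrix entries d_{ij}, and suppose d_{nn} = 0. Then d_{ii} = 0 for all i, d_{ij} = 0 whenever j ≠ n, and d(e_i) = d_{in} e_n for 1 ≤ i ≤ n−1, where the column vector (d_{1n},…,d_{n−1,n},0)ᵀ satisfies A·(d_{1n},…,d_{n−1,n},0)ᵀ = 0, i.e. ∑_{k=1}^{n−1} a_{ik} d_{kn} = 0 for all 1 ≤ i ≤ n−1. -/

import Mathlib

open Matrix Polynomial Finset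

/-- The multiplication of the evolution algebra `E(A)` on `ℂ^n` associated to the
matrix `A`: it is the unique commutative bilinear multiplication with
`e i · e j = 0` for `i ≠ j` and `e i · e i = ∑ k, A i k • e k`, where `e i = Pi.single i 1`
is the standard (natural) basis. -/
noncomputable def evolMul {n : ℕ} (A : Matrix (Fin n) (Fin n) ℂ) (u v : Fin n → ℂ) : Fin n → ℂ :=
  fun k => ∑ i, u i * v i * A i k

/-- A linear map `d : E(A) → E(A)` is a derivation if `d (u·v) = d u · v + u · d v`. -/
def IsEvolDerivation {n : ℕ} (A : Matrix (Fin n) (Fin n) ℂ)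
    (d : (Fin n → ℂ) →ₗ[ℂ] (Fin n → ℂ)) : Prop :=
  ∀ u v : Fin n → ℂ, d (evolMul A u v) = evolMul A (d u) v + evolMul A u (d v)

theorem evolMul_single_left {n : ℕ} (A : Matrix (Fin n) (Fin n) ℂ) (i : Fin n)
    (v : Fin n → ℂ) : evolMul A (Pi.single i 1) v = v i • A i := by
  funext k
  simp [evolMul, Pi.single_apply]

theorem evolMul_single_right {n : ℕ} (A : Matrix (Fin n) (Fin n) ℂ) (i : Fin n)
    (u : Fin n → ℂ) : evolMul A u (Pi.single i 1) = u i • A i := by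
  funext k
  simp [evolMul, Pi.single_apply]

namespace IsEvolDerivation

variable {n : ℕ} {A : Matrix (Fin n) (Fin n) ℂ} {d : (Fin n → ℂ) →ₗ[ℂ] (Fin n → ℂ)}

theorem smul_row_add_smul_row (hd : IsEvolDerivation A d) {i j : Fin n} (hij : i ≠ j) :
    d (Pi.single i 1) j • A j + d (Pi.single j 1) i • A i = 0 := by
  have h := hd (Pi.single i 1) (Pi.single j 1)
  rw [evolMul_single_left, evolMul_single_left, evolMul_single_right,
    Pi.single_eq_of_ne hij, zero_smul, map_zero] at h
  exact h.symm

theorem map_row (hd : IsEvolDerivation A d) (i : Fin n) :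
    d (A i) = (2 * d (Pi.single i 1) i) • A i := by
  have h := hd (Pi.single i 1) (Pi.single i 1)
  rw [evolMul_single_left, evolMul_single_left, evolMul_single_right,
    Pi.single_eq_same, one_smul] at h
  rw [h, two_mul, add_smul]

theorem sum_row_mul (hd : IsEvolDerivation A d) (i k : Fin n) :
    ∑ j, A i j * d (Pi.single j 1) k = 2 * d (Pi.single i 1) i * A i k := by
  have h := congrFun (hd.map_row i) k
  have hv : A i = ∑ j, A i j • (Pi.single j 1 : Fin n → ℂ) := by
    funext k
    simp [Finset.sum_apply, Pi.single_apply]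
  rw [hv, map_sum, ← hv, Finset.sum_apply] at h
  simpa only [map_smul, Pi.smul_apply, smul_eq_mul] using h

/-- Off the distinguished column `l` of a zero row, the matrix of a derivation is diagonal. -/
theorem apply_eq_zero_of_ne (hd : IsEvolDerivation A d) {l : Fin n}
    (hrows : LinearIndependent ℂ (fun i : {i : Fin n // i ≠ l} => A i)) (hzero : A l = 0)
    {i j : Fin n} (hij : i ≠ j) (hj : j ≠ l) : d (Pi.single i 1) j = 0 := by
  have h := hd.smul_row_add_smul_row hij
  by_cases hi : i = l
  · subst hi
    rw [hzero, smul_zero, add_zero] at h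
    exact (smul_eq_zero.mp h).resolve_right (hrows.ne_zero ⟨j, hj⟩)
  · have hp := hrows.comp ![⟨j, hj⟩, ⟨i, hi⟩] (by
      intro a b hab
      fin_cases a <;> fin_cases b <;> simp_all [eq_comm])
    have hpair : (fun i : {i : Fin n // i ≠ l} => A i) ∘ ![⟨j, hj⟩, ⟨i, hi⟩] = ![A j, A i] := by
      funext a
      fin_cases a <;> rfl
    rw [hpair] at hp
    exact (LinearIndependent.pair_iff.mp hp _ _ h).1

/-- An index at which the diagonal is of maximal modulus gives a row that would be an eigenvector
for twice that value, which is too large to be an eigenvalue unless it is zero. -/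
theorem diag_eq_zero (hd : IsEvolDerivation A d) {l : Fin n}
    (hrows : LinearIndependent ℂ (fun i : {i : Fin n // i ≠ l} => A i)) (hzero : A l = 0)
    (hl : d (Pi.single l 1) l = 0) (i : Fin n) : d (Pi.single i 1) i = 0 := by
  obtain ⟨m, -, hm⟩ := Finset.exists_max_image Finset.univ
    (fun i => ‖d (Pi.single i 1) i‖) ⟨l, Finset.mem_univ l⟩
  suffices h : d (Pi.single m 1) m = 0 by
    have := hm i (Finset.mem_univ i)
    rw [h, norm_zero] at this
    exact norm_le_zero_iff.mp this
  by_contra h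
  have hml : m ≠ l := fun e => h (e ▸ hl)
  have hk : ∀ k, k ≠ l → A m k = 0 := by
    intro k hkl
    have hs := hd.sum_row_mul m k
    rw [Finset.sum_eq_single k (fun j _ hjk => by
      rw [hd.apply_eq_zero_of_ne hrows hzero hjk hkl, mul_zero]) (by simp)] at hs
    by_contra hA
    have he : d (Pi.single k 1) k = 2 * d (Pi.single m 1) m :=
      mul_left_cancel₀ hA (by rw [hs]; ring)
    have hle := hm k (Finset.mem_univ k)
    rw [he, norm_mul, Complex.norm_ofNat] at hle
    linarith [norm_pos_iff.mpr h]
  have hs := hd.sum_row_mul m l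
  rw [Finset.sum_eq_zero (fun j _ => by
    by_cases hj : j = l
    · rw [hj, hl, mul_zero]
    · rw [hk j hj, zero_mul])] at hs
  refine hrows.ne_zero ⟨m, hml⟩ (funext fun k => ?_)
  by_cases hkl : k = l
  · subst hkl
    exact (mul_eq_zero.mp hs.symm).resolve_left (mul_ne_zero two_ne_zero h)
  · exact hk k hkl

end IsEvolDerivation

/-- Suppose the first `n-1` rows of `A` are linearly independent and the `n`-th row is
zero (i.e. `eₙ·eₙ = 0`).  If a derivation `d` of `E(A)` satisfies `dₙₙ = 0`, then all
diagonal entries of `d` vanish, `dᵢⱼ = 0` whenever `j ≠ n`, `d(eᵢ) = dᵢₙ eₙ` for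
`1 ≤ i ≤ n-1`, and `∑_{k=1}^{n-1} aᵢₖ d_{kn} = 0` for all `1 ≤ i ≤ n-1`. -/
theorem derivation_form_of_zero_last_row_dnn_zero (n : ℕ) (hn : 2 ≤ n)
    (A : Matrix (Fin n) (Fin n) ℂ)
    (hrows : LinearIndependent ℂ (fun i : Fin (n - 1) => A (Fin.castLE (Nat.sub_le n 1) i)))
    (hzero : A (⟨n - 1, by omega⟩ : Fin n) = 0)
    (d : (Fin n → ℂ) →ₗ[ℂ] (Fin n → ℂ)) (hd : IsEvolDerivation A d)
    (hdnn : d (Pi.single (⟨n - 1, by omega⟩ : Fin n) 1) (⟨n - 1, by omega⟩ : Fin n) = 0) :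
    (∀ i : Fin n, d (Pi.single i 1) i = 0) ∧
      (∀ i j : Fin n, j.val ≠ n - 1 → d (Pi.single i 1) j = 0) ∧
      (∀ i : Fin n, i.val < n - 1 →
        d (Pi.single i 1)
          = d (Pi.single i 1) (⟨n - 1, by omega⟩ : Fin n)
              • (Pi.single (⟨n - 1, by omega⟩ : Fin n) 1 : Fin n → ℂ)) ∧
      (∀ i : Fin n, i.val < n - 1 →
        ∑ k : Fin (n - 1),
          A i (Fin.castLE (Nat.sub_le n 1) k)
            * d (Pi.single (Fin.castLE (Nat.sub_le n 1) k) 1) (⟨n - 1, by omega⟩ : Fin n)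
          = 0) := by
  obtain ⟨m, rfl⟩ : ∃ m, n = m + 1 := ⟨n - 1, by omega⟩
  have hlast : (⟨m + 1 - 1, by omega⟩ : Fin (m + 1)) = Fin.last m := rfl
  have hcast : ∀ k : Fin m, Fin.castLE (Nat.sub_le (m + 1) 1) k = k.castSucc := fun _ => rfl
  simp only [hlast] at hzero hdnn ⊢
  have hrows' : LinearIndependent ℂ (fun i : {i : Fin (m + 1) // i ≠ Fin.last m} => A i) :=
    hrows.comp (fun i : {i : Fin (m + 1) // i ≠ Fin.last m} => i.1.castPred i.2)
      (fun a b hab => Subtype.ext (Fin.castPred_inj.mp hab))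
  have hdiag := hd.diag_eq_zero hrows' hzero hdnn
  have hoff : ∀ i j : Fin (m + 1), j ≠ Fin.last m → d (Pi.single i 1) j = 0 := by
    intro i j hj
    by_cases hij : i = j
    · exact hij ▸ hdiag i
    · exact hd.apply_eq_zero_of_ne hrows' hzero hij hj
  refine ⟨hdiag, fun i j hj => hoff i j fun h => hj (h ▸ rfl), fun i _ => ?_, fun i _ => ?_⟩
  · funext j
    by_cases hj : j = Fin.last m
    · simp [hj]
    · simp [hj, hoff i j hj]
  · have hs := hd.sum_row_mul i (Fin.last m)
    rw [Fin.sum_univ_castSucc, hdnn, hdiag, mul_zero, add_zero, mul_zero, zero_mul] at hs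
    exact hs
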